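/- Let Y be any nontrivial Banach space over 𝕂 = ℝ or ℂ (Y ≠ {0}). Then BS(c₀;Y) is not dense in L(c₀;Y). -/

import Mathlib

noncomputable section

/-- `x` is Birkhoff--James orthogonal to `y`: `‖x‖ ≤ ‖x + a • y‖` for every scalar `a`. -/
def BJOrth (𝕂 : Type*) [RCLike 𝕂] {E : Type*} [NormedAddCommGroup E] [NormedSpace 𝕂 E]
    (x y : E) : Prop :=
  ∀ a : 𝕂, ‖x‖ ≤ ‖x + a • y‖

/-- The Bhatia--Šemrl property for bounded linear operators: whenever `T ⊥_B S` there is a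
norm attaining point `x` of `T` with `T x ⊥_B S x`. -/
def HasBSProp (𝕂 : Type*) [RCLike 𝕂] {X Y : Type*} [NormedAddCommGroup X] [NormedSpace 𝕂 X]
    [NormedAddCommGroup Y] [NormedSpace 𝕂 Y] (T : X →L[𝕂] Y) : Prop :=
  ∀ S : X →L[𝕂] Y, BJOrth 𝕂 T S →
    ∃ x : X, ‖x‖ = 1 ∧ ‖T x‖ = ‖T‖ ∧ BJOrth 𝕂 (T x) (S x)

namespace ZeroAtInftyContinuousMap

open scoped ZeroAtInfty
open Filter Topology

variable {𝕂 : Type*} [RCLike 𝕂]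

theorem norm_apply_le (x : C₀(ℕ, 𝕂)) (i : ℕ) : ‖x i‖ ≤ ‖x‖ := by
  rw [← norm_toBCF_eq_norm]
  exact x.toBCF.norm_coe_le_norm i

theorem norm_le_of_forall_norm_apply_le {x : C₀(ℕ, 𝕂)} {C : ℝ} (hC : 0 ≤ C)
    (h : ∀ i, ‖x i‖ ≤ C) : ‖x‖ ≤ C := by
  rw [← norm_toBCF_eq_norm]
  exact (BoundedContinuousFunction.norm_le hC).2 h

theorem eventually_norm_apply_lt (x : C₀(ℕ, 𝕂)) {C : ℝ} (hC : 0 < C) :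
    ∃ N : ℕ, ∀ i, N ≤ i → ‖x i‖ < C := by
  have h := x.zero_at_infty'
  rw [cocompact_eq_cofinite, Nat.cofinite_eq_atTop] at h
  have h' := h.norm
  rw [norm_zero] at h'
  exact eventually_atTop.1 (h'.eventually_lt_const hC)

variable (𝕂) in
/-- The `i`-th coordinate functional on `c₀`. -/
def coordCLM (i : ℕ) : C₀(ℕ, 𝕂) →L[𝕂] 𝕂 :=
  LinearMap.mkContinuous
    { toFun := fun x => x i, map_add' := fun _ _ => rfl, map_smul' := fun _ _ => rfl } 1
    fun x => by simpa using norm_apply_le x i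

@[simp]
theorem coordCLM_apply (i : ℕ) (x : C₀(ℕ, 𝕂)) : coordCLM 𝕂 i x = x i := rfl

variable (𝕂) in
/-- The `i`-th unit vector of `c₀`. -/
def unitVec (i : ℕ) : C₀(ℕ, 𝕂) where
  toFun := Pi.single i 1
  continuous_toFun := continuous_of_discreteTopology
  zero_at_infty' := by
    rw [cocompact_eq_cofinite, Nat.cofinite_eq_atTop]
    refine tendsto_const_nhds.congr' ?_
    filter_upwards [eventually_gt_atTop i] with j hj
    rw [Pi.single_eq_of_ne hj.ne']

theorem unitVec_apply (i j : ℕ) : unitVec 𝕂 i j = if j = i then 1 else 0 :=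
  Pi.single_apply i (1 : 𝕂) j

theorem norm_unitVec_le (i : ℕ) : ‖unitVec 𝕂 i‖ ≤ 1 :=
  norm_le_of_forall_norm_apply_le zero_le_one fun j => by
    rw [unitVec_apply]; split_ifs <;> simp

/-- A functional attaining its norm at `x` vanishes on the unit vectors at which the coordinate of
`x` is not unimodular. -/
theorem apply_unitVec_eq_zero {f : C₀(ℕ, 𝕂) →L[𝕂] 𝕂} {M : ℝ} (hf : ‖f‖ ≤ M) {x : C₀(ℕ, 𝕂)}
    (hx : ‖x‖ ≤ 1) (hfx : f x = M) {i : ℕ} (hi : ‖x i‖ < 1) : f (unitVec 𝕂 i) = 0 := by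
  by_contra hne
  have hpos : 0 < ‖f (unitVec 𝕂 i)‖ := norm_pos_iff.2 hne
  have hM : 0 ≤ M := (norm_nonneg f).trans hf
  set u := f (unitVec 𝕂 i) with hu
  obtain ⟨c, hc, hcu⟩ : ∃ c : 𝕂, ‖c‖ = 1 ∧ c * u = (‖u‖ : 𝕂) :=
    RCLike.exists_norm_eq_mul_self u |>.imp fun c h => ⟨h.1, h.2.symm⟩
  set t : 𝕂 := ((1 - ‖x i‖ : ℝ) : 𝕂) * c with ht
  have htn : ‖t‖ = 1 - ‖x i‖ := by
    rw [ht, norm_mul, hc, mul_one, RCLike.norm_ofReal, abs_of_pos (by linarith)]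
  have hz : ‖x + t • unitVec 𝕂 i‖ ≤ 1 := by
    refine norm_le_of_forall_norm_apply_le zero_le_one fun j => ?_
    rw [add_apply, smul_apply, unitVec_apply]
    split_ifs with h
    · subst h
      calc _ ≤ ‖x j‖ + ‖t • (1 : 𝕂)‖ := norm_add_le _ _
        _ ≤ 1 := by rw [smul_eq_mul, mul_one, htn]; linarith
    · simpa using (norm_apply_le x j).trans hx
  have hval : f (x + t • unitVec 𝕂 i) = ((M + (1 - ‖x i‖) * ‖u‖ : ℝ) : 𝕂) := by
    rw [map_add, map_smul, hfx, ← hu, ht, smul_eq_mul, mul_assoc, hcu]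
    push_cast
    ring
  have hle : ‖f (x + t • unitVec 𝕂 i)‖ ≤ M :=
    (f.le_opNorm_of_le hz).trans (by rwa [mul_one])
  have hprod : 0 < (1 - ‖x i‖) * ‖u‖ := mul_pos (by linarith) hpos
  rw [hval, RCLike.norm_ofReal, abs_of_pos (by linarith)] at hle
  linarith

/-- The vector agreeing with `x`, except that its coordinates in `[N, N + n)` equal `x 0`. -/
def extendHead (x : C₀(ℕ, 𝕂)) (N n : ℕ) : C₀(ℕ, 𝕂) :=
  x + ∑ k ∈ Finset.range n, (x 0 - x (N + k)) • unitVec 𝕂 (N + k)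

theorem extendHead_apply (x : C₀(ℕ, 𝕂)) (N n j : ℕ) :
    extendHead x N n j = if N ≤ j ∧ j < N + n then x 0 else x j := by
  have h : extendHead x N n j = x j + ∑ k ∈ Finset.range n,
      (x 0 - x (N + k)) * (if j = N + k then 1 else 0) := by
    rw [← coordCLM_apply, extendHead, map_add, map_sum]
    simp [unitVec_apply]
  rw [h]
  split_ifs with hj
  · rw [Finset.sum_eq_single (j - N)]
    · rw [Nat.add_sub_cancel' hj.1]; simp
    · intro k _ hk
      rw [if_neg (by omega), mul_zero]
    · intro hk
      exact absurd (Finset.mem_range.2 (by omega)) hk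
  · rw [Finset.sum_eq_zero, add_zero]
    intro k hk
    rw [if_neg (by have := Finset.mem_range.1 hk; omega), mul_zero]

theorem norm_extendHead_le (x : C₀(ℕ, 𝕂)) (N n : ℕ) : ‖extendHead x N n‖ ≤ ‖x‖ :=
  norm_le_of_forall_norm_apply_le (norm_nonneg x) fun j => by
    rw [extendHead_apply]
    split_ifs <;> exact norm_apply_le x _

theorem norm_half_pow (k : ℕ) : ‖((1 / 2 / 2 ^ k : ℝ) : 𝕂)‖ = 1 / 2 / 2 ^ k := by
  rw [RCLike.norm_ofReal, abs_of_pos (by positivity)]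

theorem hasSum_half_pow : HasSum (fun k : ℕ => (1 / 2 / 2 ^ k : ℝ)) 1 := hasSum_geometric_two' 1

theorem norm_half_pow_mul_apply_le (x : C₀(ℕ, 𝕂)) (N k : ℕ) :
    ‖((1 / 2 / 2 ^ k : ℝ) : 𝕂) * x (N + k)‖ ≤ 1 / 2 / 2 ^ k * ‖x‖ := by
  rw [norm_mul, norm_half_pow]
  gcongr
  exact norm_apply_le x _

theorem summable_half_pow_mul_apply (x : C₀(ℕ, 𝕂)) (N : ℕ) :
    Summable fun k : ℕ => ((1 / 2 / 2 ^ k : ℝ) : 𝕂) * x (N + k) :=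
  Summable.of_norm_bounded (hasSum_half_pow.summable.mul_right ‖x‖)
    (norm_half_pow_mul_apply_le x N)

variable (𝕂) in
/-- The functional `x ↦ x 0 - ∑ k, 2 ^ (-(k + 1)) * x (N + k)` on `c₀`. -/
def headSubTail (N : ℕ) : C₀(ℕ, 𝕂) →L[𝕂] 𝕂 :=
  LinearMap.mkContinuous
    { toFun := fun x => x 0 - ∑' k : ℕ, ((1 / 2 / 2 ^ k : ℝ) : 𝕂) * x (N + k)
      map_add' := fun x y => by
        simp only [add_apply, mul_add]
        rw [(summable_half_pow_mul_apply x N).tsum_add (summable_half_pow_mul_apply y N)]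
        ring
      map_smul' := fun c x => by
        simp only [smul_apply, smul_eq_mul, mul_left_comm _ c, tsum_mul_left, RingHom.id_apply,
          mul_sub] } 2
    fun x => by
      have h := tsum_of_norm_bounded (hasSum_half_pow.mul_right ‖x‖)
        (norm_half_pow_mul_apply_le x N)
      refine (norm_sub_le _ _).trans ?_
      linarith [norm_apply_le x 0]

theorem headSubTail_apply (N : ℕ) (x : C₀(ℕ, 𝕂)) :
    headSubTail 𝕂 N x = x 0 - ∑' k : ℕ, ((1 / 2 / 2 ^ k : ℝ) : 𝕂) * x (N + k) := rfl

theorem headSubTail_ne_zero (N : ℕ) {x : C₀(ℕ, 𝕂)} (hx : ‖x‖ ≤ 1) (h0 : ‖x 0‖ = 1) :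
    headSubTail 𝕂 N x ≠ 0 := by
  rw [headSubTail_apply, sub_ne_zero]
  intro h
  have hle : ∀ k : ℕ, ‖((1 / 2 / 2 ^ k : ℝ) : 𝕂) * x (N + k)‖ ≤ 1 / 2 / 2 ^ k := fun k =>
    (norm_half_pow_mul_apply_le x N k).trans (mul_le_of_le_one_right (by positivity) hx)
  have hs := (summable_half_pow_mul_apply x N).norm
  obtain ⟨m, hm⟩ := eventually_norm_apply_lt x one_pos
  have hlt : ‖((1 / 2 / 2 ^ m : ℝ) : 𝕂) * x (N + m)‖ < 1 / 2 / 2 ^ m := by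
    rw [norm_mul, norm_half_pow]
    exact mul_lt_of_lt_one_right (by positivity) (hm _ (by omega))
  have := hs.tsum_lt_tsum hle hlt hasSum_half_pow.summable
  rw [hasSum_half_pow.tsum_eq] at this
  have h1 := norm_tsum_le_tsum_norm hs
  rw [← h, h0] at h1
  linarith

theorem tendsto_headSubTail_extendHead (x : C₀(ℕ, 𝕂)) {N : ℕ} (hN : 0 < N) :
    Tendsto (fun n => headSubTail 𝕂 N (extendHead x N n)) atTop (𝓝 0) := by
  have hsum : ∑' k : ℕ, ((1 / 2 / 2 ^ k : ℝ) : 𝕂) * x 0 = x 0 := by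
    have h := (hasSum_half_pow.mapL (RCLike.ofRealCLM (K := 𝕂))).mul_right (x 0)
    simpa using h.tsum_eq
  have hlim : Tendsto (fun n => ∑' k : ℕ, ((1 / 2 / 2 ^ k : ℝ) : 𝕂) * extendHead x N n (N + k))
      atTop (𝓝 (∑' k : ℕ, ((1 / 2 / 2 ^ k : ℝ) : 𝕂) * x 0)) := by
    refine tendsto_tsum_of_dominated_convergence (bound := fun k : ℕ => 1 / 2 / 2 ^ k * ‖x‖)
      (hasSum_half_pow.summable.mul_right _) (fun k => ?_) (Eventually.of_forall fun n k => ?_)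
    · refine tendsto_const_nhds.congr' ?_
      filter_upwards [eventually_gt_atTop k] with n hn
      rw [extendHead_apply, if_pos (by omega)]
    · exact (norm_half_pow_mul_apply_le _ N k).trans
        (mul_le_mul_of_nonneg_left (norm_extendHead_le x N n) (by positivity))
  rw [hsum] at hlim
  have h0 : ∀ n, extendHead x N n 0 = x 0 := fun n => by
    rw [extendHead_apply, if_neg (by omega)]
  simp_rw [headSubTail_apply, h0]
  simpa using hlim.const_sub (x 0)

variable {Y : Type*} [NormedAddCommGroup Y] [NormedSpace 𝕂 Y]

/-- If `f` attains its norm `‖T‖` at `x` and the coordinates of `x` from `N` on are not unimodular,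
then `T` is orthogonal to the rank-one operator `headSubTail 𝕂 N ⊗ y`. -/
theorem bjOrth_smulRight_headSubTail {T : C₀(ℕ, 𝕂) →L[𝕂] Y} {φ : Y →L[𝕂] 𝕂} (hφ : ‖φ‖ ≤ 1)
    {x : C₀(ℕ, 𝕂)} (hx : ‖x‖ ≤ 1) (hφx : φ (T x) = (‖T‖ : 𝕂)) {N : ℕ} (hN : 0 < N)
    (hxN : ∀ i, N ≤ i → ‖x i‖ < 1) (y : Y) :
    BJOrth 𝕂 T ((headSubTail 𝕂 N).smulRight y) := by
  intro a
  have hφT : ‖φ.comp T‖ ≤ ‖T‖ :=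
    (φ.opNorm_comp_le T).trans (mul_le_of_le_one_left (norm_nonneg T) hφ)
  have hval : ∀ n, φ (T (extendHead x N n)) = (‖T‖ : 𝕂) := fun n => by
    rw [extendHead, map_add, map_add, hφx, map_sum, map_sum, Finset.sum_eq_zero, add_zero]
    intro k _
    have h := apply_unitVec_eq_zero (f := φ.comp T) hφT hx hφx (hxN (N + k) (by omega))
    rw [ContinuousLinearMap.comp_apply] at h
    rw [map_smul, map_smul, h, smul_zero]
  have hle : ∀ n, ‖T‖ ≤ ‖T + a • (headSubTail 𝕂 N).smulRight y‖ +
      ‖a • headSubTail 𝕂 N (extendHead x N n) • y‖ := fun n => by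
    set z := extendHead x N n with hz
    have hz1 : ‖z‖ ≤ 1 := (norm_extendHead_le x N n).trans hx
    have h1 : ‖T‖ ≤ ‖T z‖ := by
      have h := φ.le_of_opNorm_le hφ (T z)
      rwa [hval, RCLike.norm_ofReal, abs_of_nonneg (norm_nonneg T), one_mul] at h
    have h2 := (T + a • (headSubTail 𝕂 N).smulRight y).unit_le_opNorm z hz1
    have h3 : T z = (T + a • (headSubTail 𝕂 N).smulRight y) z - a • headSubTail 𝕂 N z • y := by
      simp
    have h4 := norm_sub_le ((T + a • (headSubTail 𝕂 N).smulRight y) z) (a • headSubTail 𝕂 N z • y)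
    rw [← h3] at h4
    linarith
  have hlim := ((((tendsto_headSubTail_extendHead x hN).smul_const y).const_smul a).norm).const_add
    ‖T + a • (headSubTail 𝕂 N).smulRight y‖
  rw [zero_smul, smul_zero, norm_zero, add_zero] at hlim
  exact ge_of_tendsto' hlim hle

/-- If `T` is close to the rank-one operator `coordCLM 𝕂 0 ⊗ y`, then the first coordinate of every
point at which `T` attains its norm is unimodular. -/
theorem norm_apply_zero_eq_one_of_norm_attaining {T : C₀(ℕ, 𝕂) →L[𝕂] Y} {y : Y}
    (hT : ‖T - (coordCLM 𝕂 0).smulRight y‖ < 1 / 4) (hTn : 3 / 4 < ‖T‖)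
    {φ : Y →L[𝕂] 𝕂} (hφ : ‖φ‖ ≤ 1) {x : C₀(ℕ, 𝕂)} (hx : ‖x‖ ≤ 1) (hφx : φ (T x) = (‖T‖ : 𝕂)) :
    ‖x 0‖ = 1 := by
  have hφT : ‖φ.comp T‖ ≤ ‖T‖ :=
    (φ.opNorm_comp_le T).trans (mul_le_of_le_one_left (norm_nonneg T) hφ)
  have hx0 : ‖x 0‖ ≤ 1 := (norm_apply_le x 0).trans hx
  have hclose : ∀ z : C₀(ℕ, 𝕂), ‖z‖ ≤ 1 → ‖φ (T z) - z 0 * φ y‖ < 1 / 4 := fun z hz => by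
    have h1 := (T - (coordCLM 𝕂 0).smulRight y).unit_le_opNorm z hz
    have h2 := φ.le_of_opNorm_le hφ ((T - (coordCLM 𝕂 0).smulRight y) z)
    have h3 : φ ((T - (coordCLM 𝕂 0).smulRight y) z) = φ (T z) - z 0 * φ y := by simp
    rw [h3] at h2
    linarith
  refine hx0.eq_of_not_lt fun hlt => ?_
  have h0 : φ (T (unitVec 𝕂 0)) = 0 :=
    apply_unitVec_eq_zero (f := φ.comp T) hφT hx hφx hlt
  have h1 := hclose _ (norm_unitVec_le 0)
  rw [h0, unitVec_apply, if_pos rfl, one_mul, zero_sub, norm_neg] at h1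
  have h2 := hclose x hx
  rw [hφx] at h2
  have h3 := norm_sub_norm_le ((‖T‖ : 𝕂)) (x 0 * φ y)
  rw [norm_mul, RCLike.norm_ofReal, abs_of_nonneg (norm_nonneg T)] at h3
  have h4 : ‖x 0‖ * ‖φ y‖ ≤ ‖φ y‖ := mul_le_of_le_one_left (norm_nonneg _) hx0
  linarith

/-- Operators close to the rank-one operator `coordCLM 𝕂 0 ⊗ y`, with `‖y‖ = 1`, fail the
Bhatia--Šemrl property. -/
theorem not_hasBSProp_of_norm_sub_lt {T : C₀(ℕ, 𝕂) →L[𝕂] Y} {y : Y} (hy : ‖y‖ = 1)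
    (hT : ‖T - (coordCLM 𝕂 0).smulRight y‖ < 1 / 4) : ¬ HasBSProp 𝕂 T := by
  intro hBS
  have hTn : 3 / 4 < ‖T‖ := by
    have h1 := ((coordCLM 𝕂 0).smulRight y).unit_le_opNorm _ (norm_unitVec_le 0)
    rw [ContinuousLinearMap.smulRight_apply, coordCLM_apply, unitVec_apply, if_pos rfl, one_smul,
      hy] at h1
    have h2 := norm_sub_norm_le ((coordCLM 𝕂 0).smulRight y) T
    rw [norm_sub_rev _ T] at h2
    linarith
  have hsupp : ∀ x, ‖T x‖ = ‖T‖ → ∃ φ : Y →L[𝕂] 𝕂, ‖φ‖ ≤ 1 ∧ φ (T x) = (‖T‖ : 𝕂) := by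
    intro x hTx
    obtain ⟨φ, hφ, h⟩ := exists_dual_vector 𝕂 (T x) (by linarith)
    exact ⟨φ, hφ.le, by rw [h, hTx]⟩
  obtain ⟨x, hx, hTx, -⟩ := hBS 0 fun a => by simp
  obtain ⟨φ, hφ, hφx⟩ := hsupp x hTx
  obtain ⟨N, hN⟩ := eventually_norm_apply_lt x one_pos
  obtain ⟨z, hz, hTz, hortho⟩ := hBS _ (bjOrth_smulRight_headSubTail hφ hx.le hφx N.succ_pos
    (fun i hi => hN i (by omega)) y)
  obtain ⟨ψ, hψ, hψz⟩ := hsupp z hTz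
  have hz0 := norm_apply_zero_eq_one_of_norm_attaining hT hTn hψ hz.le hψz
  have hne := headSubTail_ne_zero (N + 1) hz.le hz0
  have h1 := hortho (-(z 0 / headSubTail 𝕂 (N + 1) z))
  have h2 : T z + -(z 0 / headSubTail 𝕂 (N + 1) z) • (headSubTail 𝕂 (N + 1)).smulRight y z =
      (T - (coordCLM 𝕂 0).smulRight y) z := by
    rw [ContinuousLinearMap.smulRight_apply, smul_smul, neg_mul, div_mul_cancel₀ _ hne, neg_smul,
      ← sub_eq_add_neg]
    rfl
  rw [h2, hTz] at h1
  have h3 := (T - (coordCLM 𝕂 0).smulRight y).unit_le_opNorm z hz.le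
  linarith

end ZeroAtInftyContinuousMap

open scoped ZeroAtInfty in
/-- For every nontrivial Banach space `Y`, the operators in `L(c₀;Y)` with the
Bhatia--Šemrl property are not dense. -/
theorem BS_not_dense_c0 {𝕂 Y : Type*} [RCLike 𝕂]
    [NormedAddCommGroup Y] [NormedSpace 𝕂 Y] [CompleteSpace Y] [Nontrivial Y] :
    ¬ Dense {T : C₀(ℕ, 𝕂) →L[𝕂] Y | HasBSProp 𝕂 T} := by
  intro hdense
  obtain ⟨y, hy⟩ := exists_ne (0 : Y)
  obtain ⟨T, hT, hBS⟩ := Metric.dense_iff.1 hdense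
    ((ZeroAtInftyContinuousMap.coordCLM 𝕂 0).smulRight ((‖y‖⁻¹ : 𝕂) • y)) (1 / 4) (by norm_num)
  exact ZeroAtInftyContinuousMap.not_hasBSProp_of_norm_sub_lt (norm_smul_inv_norm hy)
    ((mem_ball_iff_norm (E := C₀(ℕ, 𝕂) →L[𝕂] Y)).1 hT) hBS
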